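/- The function U(x,t) = sin(x)/√(cos²(x) − e^{2t}), defined on the set {(x,t) : cos²(x) > e^{2t}}, satisfies the nonlinear diffusion equation U_t = ∂_x(U_x/(1 + U²)) at every point of its domain. -/

import Mathlib

theorem oval_aux_sqrt (E x : ℝ) (h : E < (Real.cos x) ^ 2) :
    HasDerivAt (fun ξ => Real.sqrt ((Real.cos ξ) ^ 2 - E))
      (-(Real.sin x * Real.cos x) / Real.sqrt ((Real.cos x) ^ 2 - E)) x := by
  have h1 := (((Real.hasDerivAt_cos x).pow 2).sub_const E).sqrt (sub_pos.2 h).ne'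
  have hS : Real.sqrt ((Real.cos x) ^ 2 - E) ≠ 0 := (Real.sqrt_pos.2 (sub_pos.2 h)).ne'
  refine HasDerivAt.congr_deriv h1 ?_
  simp only [Pi.pow_apply]
  field_simp
  norm_num
  try ring

/-- `U(x,t) = sin(x)/√(cos²(x) − e^{2t})` satisfies the nonlinear diffusion equation
`U_t = ∂_x (U_x / (1 + U²))` on its domain `{(x,t) : cos²(x) > e^{2t}}`. -/
theorem oval_slope_solves_diffusion
    (U : ℝ → ℝ → ℝ)
    (hU : ∀ x t : ℝ, U x t = Real.sin x / Real.sqrt ((Real.cos x) ^ 2 - Real.exp (2 * t)))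
    (x t : ℝ) (h : Real.exp (2 * t) < (Real.cos x) ^ 2) :
    deriv (fun τ => U x τ) t
      = deriv (fun ξ => deriv (fun ξ' => U ξ' t) ξ / (1 + (U ξ t) ^ 2)) x := by
  have hS := Real.sqrt_pos.2 (sub_pos.2 h)
  have hS2 := Real.sq_sqrt (sub_pos.2 h).le
  simp only [hU]
  have hL : HasDerivAt (fun τ => Real.sin x / Real.sqrt ((Real.cos x) ^ 2 - Real.exp (2 * τ)))
      (Real.sin x * Real.exp (2 * t) / Real.sqrt ((Real.cos x) ^ 2 - Real.exp (2 * t)) ^ 3) t := by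
    have h1 := ((((hasDerivAt_id t).const_mul 2).exp).const_sub ((Real.cos x) ^ 2)).sqrt
      (sub_pos.2 h).ne'
    have h2 := (hasDerivAt_const t (Real.sin x)).div h1 hS.ne'
    refine HasDerivAt.congr_deriv h2 ?_
    simp only [id]
    field_simp
    try ring
  rw [hL.deriv]
  have hev : (fun ξ => deriv (fun ξ' => Real.sin ξ' /
        Real.sqrt ((Real.cos ξ') ^ 2 - Real.exp (2 * t))) ξ /
        (1 + (Real.sin ξ / Real.sqrt ((Real.cos ξ) ^ 2 - Real.exp (2 * t))) ^ 2))
      =ᶠ[nhds x] fun ξ => Real.cos ξ / Real.sqrt ((Real.cos ξ) ^ 2 - Real.exp (2 * t)) := by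
    have hc : ContinuousAt (fun ξ => (Real.cos ξ) ^ 2) x := by fun_prop
    filter_upwards [hc.eventually (lt_mem_nhds h)] with y hy
    have hT := Real.sqrt_pos.2 (sub_pos.2 hy)
    have hT2 := Real.sq_sqrt (sub_pos.2 hy).le
    have hd := (Real.hasDerivAt_sin y).div (oval_aux_sqrt _ y hy) hT.ne'
    have hd' := hd.deriv
    simp only [Pi.div_def] at hd'
    rw [hd']
    generalize Real.sqrt ((Real.cos y) ^ 2 - Real.exp (2 * t)) = T at *
    have hp : 0 < T ^ 2 + Real.sin y ^ 2 := by positivity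
    have hp' : 0 < 1 + (Real.sin y / T) ^ 2 := by positivity
    rw [div_eq_div_iff hp'.ne' hT.ne']
    field_simp
    try ring
  rw [hev.deriv_eq]
  have hd := ((Real.hasDerivAt_cos x).div (oval_aux_sqrt _ x h) hS.ne').deriv
  simp only [Pi.div_def] at hd
  rw [hd]
  have hE : Real.exp (2 * t) = Real.cos x ^ 2 -
    Real.sqrt ((Real.cos x) ^ 2 - Real.exp (2 * t)) ^ 2 := by rw [hS2]; ring
  generalize Real.sqrt ((Real.cos x) ^ 2 - Real.exp (2 * t)) = T at *
  rw [hE]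
  field_simp
  try ring
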